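/- BC protocols and extended BC protocols represent the same class of protocols up to strong envy-equivalence: every BC protocol is itself an extended BC protocol, and every extended BC protocol is strongly envy-equivalent to some BC protocol. -/

import Mathlib

/-! ## Cake, valuations, envy, abstract game forms -/

/-- A piece of cake: a finite list of subintervals of `[0,1]`, given by endpoint pairs. -/
abbrev Piece := List (ℝ × ℝ)

/-- A valuation function on subintervals of `[0,1]`: nonnegative, normalized,
additive and divisible. -/
structure CakeValuation where
  v : ℝ → ℝ → ℝ
  nonneg : ∀ a b, 0 ≤ a → a ≤ b → b ≤ 1 → 0 ≤ v a b
  normalized : v 0 1 = 1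
  additive : ∀ a b c, 0 ≤ a → a ≤ b → b ≤ c → c ≤ 1 → v a b + v b c = v a c
  divisible : ∀ a b, 0 ≤ a → a ≤ b → b ≤ 1 → ∀ lam : ℝ, 0 ≤ lam → lam ≤ 1 →
    ∃ c, a ≤ c ∧ c ≤ b ∧ v a c = lam * v a b

/-- The value of a piece of cake: the sum of the values of its intervals. -/
def pieceValue (V : CakeValuation) (P : Piece) : ℝ := (P.map fun q => V.v q.1 q.2).sum

/-- The envy of agent `i` towards agent `j` under allocation `A`. -/
def envy {n : ℕ} (V : CakeValuation) (A : Fin n → Piece) (i j : Fin n) : ℝ :=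
  max (pieceValue V (A j) - pieceValue V (A i)) 0

/-- An abstract cake-cutting protocol, viewed as an extensive-form game:
each agent has a type of strategies, and a strategy profile determines the
final allocation of pieces of cake to the agents. -/
structure GameForm (n : ℕ) where
  Strategy : Fin n → Type
  play : (∀ i, Strategy i) → Fin n → Piece

/-- Agent `i`, with private valuation `V`, can guarantee the envy bounds
`envy (i, j) ≤ M j` for all `j ∈ S` in protocol `P`: `i` has a strategy such that
against all strategies of the other agents the bounds hold. -/
def Guarantees {n : ℕ} (P : GameForm n) (i : Fin n) (S : Finset (Fin n))
    (M : Fin n → ℝ) (V : CakeValuation) : Prop :=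
  ∃ s : P.Strategy i, ∀ σ : ∀ j, P.Strategy j, σ i = s →
    ∀ j ∈ S, envy V (P.play σ) i j ≤ M j

/-- Two protocols are strongly envy-equivalent if every agent can guarantee the same
simultaneous envy bounds (with values in `[0,1]`, against any set `S` of other agents)
in both. -/
def StronglyEnvyEquiv {n : ℕ} (P P' : GameForm n) : Prop :=
  ∀ (i : Fin n) (S : Finset (Fin n)), i ∉ S →
    ∀ M : Fin n → ℝ, (∀ j ∈ S, M j ∈ Set.Icc (0 : ℝ) 1) →
      ∀ V : CakeValuation, (Guarantees P i S M V ↔ Guarantees P' i S M V)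

/-! ## Histories and strategies -/

/-- An execution history: the sequence of cut points made (`Sum.inl`)
and of discrete choices taken (`Sum.inr`) so far. -/
abbrev Hist := List (ℝ ⊕ ℕ)

/-- A strategy of an agent: as a function of the execution history, where to cut
at a node where the agent cuts, and which index to pick at a node where the agent
chooses. -/
structure BCStrategy where
  cutAt : Hist → ℝ
  chooseAt : Hist → ℕ

/-- The initial reference points of the cake `[0,1]`. -/
def initPts : Fin 2 → ℝ := fun t => if t = 0 then 0 else 1

/-- Turn a list of (interval, agent) pairs into an allocation. -/
def allocOf {n : ℕ} (L : List (ℝ × ℝ × Fin n)) : Fin n → Piece :=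
  fun a => (L.filter fun q => decide (q.2.2 = a)).map fun q => (q.1, q.2.1)

/-! ## Branch choice (BC) protocols -/

/-- A branch choice (BC) protocol tree over `n` agents, indexed by the number of cuts
made so far.  At a `cut` node, the designated agent makes one cut inside the `j`-th
contiguous piece of the current partition of the cake (such a node has one child);
at a `choose` node the designated agent selects which child the execution proceeds to;
a `leaf` assigns each contiguous piece of the final partition to an agent. -/
inductive BCTree (n : ℕ) : ℕ → Type
  | leaf {m : ℕ} (alloc : Fin (m + 1) → Fin n) : BCTree n m
  | cut {m : ℕ} (agent : Fin n) (piece : Fin (m + 1)) (child : BCTree n (m + 1)) : BCTree n m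
  | choose {m : ℕ} (agent : Fin n) {k : ℕ} (children : Fin (k + 1) → BCTree n m) : BCTree n m

/-- Insert a new cut point `y` inside the `j`-th piece of the sorted partition `c`. -/
def insertPt {m : ℕ} (c : Fin (m + 2) → ℝ) (j : Fin (m + 1)) (y : ℝ) : Fin (m + 3) → ℝ :=
  fun t =>
    if h1 : (t : ℕ) ≤ (j : ℕ) then c ⟨t, by have := j.isLt; omega⟩
    else if (t : ℕ) = (j : ℕ) + 1 then y
    else c ⟨(t : ℕ) - 1, by have := t.isLt; omega⟩

/-- Playing a BC protocol: given the sorted cut points made so far, the execution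
history, and a strategy profile, compute the final list of (interval, agent) pairs. -/
def BCTree.playAlloc {n : ℕ} : {m : ℕ} → BCTree n m → (Fin (m + 2) → ℝ) → Hist →
    (Fin n → BCStrategy) → List (ℝ × ℝ × Fin n)
  | m, .leaf alloc, c, _, _ =>
      (List.finRange (m + 1)).map fun t => (c t.castSucc, c t.succ, alloc t)
  | _, .cut i j child, c, h, σ =>
      let y := max (c j.castSucc) (min ((σ i).cutAt h) (c j.succ))
      child.playAlloc (insertPt c j y) (h ++ [Sum.inl y]) σ
  | _, @BCTree.choose _ _ i k children, c, h, σ =>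
      let t : Fin (k + 1) := ⟨(σ i).chooseAt h % (k + 1), Nat.mod_lt _ (Nat.succ_pos k)⟩
      (children t).playAlloc c (h ++ [Sum.inr (t : ℕ)]) σ

/-- The extensive-form game determined by a BC protocol. -/
def BCTree.toGame {n : ℕ} (t : BCTree n 0) : GameForm n where
  Strategy := fun _ => BCStrategy
  play := fun σ => allocOf (t.playAlloc initPts [] σ)

/-! ## Extended BC protocols -/

/-- An extended BC protocol tree over `n` agents, indexed by the number of cuts made
so far.  Cut points are referred to by their index of creation (index `0` is the point
`0`, index `1` is the point `1`, and index `t+2` is the `t`-th cut made).  At a `cut`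
node the designated agent makes one cut anywhere between the two existing (possibly
non-consecutive) cut points `a` and `b`; at a `choose` node the designated agent
selects which child the execution proceeds to; a `leaf` allocates, for each listed
pair of existing cut points, the whole piece of cake lying between them to the listed
agent. -/
inductive ExtTree (n : ℕ) : ℕ → Type
  | leaf {m : ℕ} (alloc : List (Fin (m + 2) × Fin (m + 2) × Fin n)) : ExtTree n m
  | cut {m : ℕ} (agent : Fin n) (a b : Fin (m + 2)) (child : ExtTree n (m + 1)) : ExtTree n m
  | choose {m : ℕ} (agent : Fin n) {k : ℕ} (children : Fin (k + 1) → ExtTree n m) : ExtTree n m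

/-- Record a newly created cut point `y`. -/
def extendPt {m : ℕ} (p : Fin (m + 2) → ℝ) (y : ℝ) : Fin (m + 3) → ℝ :=
  fun t => if h : (t : ℕ) < m + 2 then p ⟨t, h⟩ else y

/-- Playing an extended BC protocol: given the cut points made so far (indexed by
creation order), the execution history and a strategy profile, compute the final list
of (interval, agent) pairs. -/
def ExtTree.playAlloc {n : ℕ} : {m : ℕ} → ExtTree n m → (Fin (m + 2) → ℝ) → Hist →
    (Fin n → BCStrategy) → List (ℝ × ℝ × Fin n)
  | _, .leaf alloc, p, _, _ => alloc.map fun q => (p q.1, p q.2.1, q.2.2)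
  | _, .cut i a b child, p, h, σ =>
      let lo := min (p a) (p b)
      let hi := max (p a) (p b)
      let y := max lo (min ((σ i).cutAt h) hi)
      child.playAlloc (extendPt p y) (h ++ [Sum.inl y]) σ
  | _, @ExtTree.choose _ _ i k children, p, h, σ =>
      let t : Fin (k + 1) := ⟨(σ i).chooseAt h % (k + 1), Nat.mod_lt _ (Nat.succ_pos k)⟩
      (children t).playAlloc p (h ++ [Sum.inr (t : ℕ)]) σ

/-- A list of (interval, agent) pairs partitions the cake `[0,1]`: it can be reordered
into a sequence of intervals with nonnegative lengths, chained end to end from `0`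
to `1`.  In particular, for each listed piece the left endpoint is at most the right
endpoint. -/
def PartitionsCake {n : ℕ} (L : List (ℝ × ℝ × Fin n)) : Prop :=
  ∃ L' : List (ℝ × ℝ × Fin n), L'.Perm L ∧
    (∀ q ∈ L', q.1 ≤ q.2.1) ∧
    List.Chain' (fun q r => q.2.1 = r.1) L' ∧
    (L'.head?.map fun q => q.1) = some 0 ∧
    (L'.getLast?.map fun q => q.2.1) = some 1

/-- An extended BC protocol: an extended BC tree which is well formed, i.e. whatever
the agents do, at the leaf reached, each allocated piece lies between cut points
`x ≤ y` and the allocated pieces partition the entire cake. -/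
structure ExtProtocol (n : ℕ) where
  tree : ExtTree n 0
  valid : ∀ σ : Fin n → BCStrategy, PartitionsCake (tree.playAlloc initPts [] σ)

/-- The extensive-form game determined by an extended BC protocol. -/
def ExtProtocol.toGame {n : ℕ} (E : ExtProtocol n) : GameForm n where
  Strategy := fun _ => BCStrategy
  play := fun σ => allocOf (E.tree.playAlloc initPts [] σ)

/-- The number of nodes of an extended BC tree. -/
def ExtTree.size {n : ℕ} : {m : ℕ} → ExtTree n m → ℕ
  | _, .leaf _ => 1
  | _, .cut _ _ _ child => child.size + 1
  | _, @ExtTree.choose _ _ _ k children => (∑ t : Fin (k + 1), (children t).size) + 1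

/-- An extended BC tree contains a cut node. -/
def ExtTree.hasCut {n : ℕ} : {m : ℕ} → ExtTree n m → Prop
  | _, .leaf _ => False
  | _, .cut _ _ _ _ => True
  | _, @ExtTree.choose _ _ _ _ children => ∃ t, (children t).hasCut

/-- No choose node of the tree has a cut node among its descendants. -/
def ExtTree.cutsBeforeChoices {n : ℕ} : {m : ℕ} → ExtTree n m → Prop
  | _, .leaf _ => True
  | _, .cut _ _ _ child => child.cutsBeforeChoices
  | _, @ExtTree.choose _ _ _ _ children => ∀ t, ¬ (children t).hasCut

/-! ## Abstract game trees -/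

/-- A game tree in which all the cut points have been made explicit. -/
inductive GT (n : ℕ) : Type
  | leaf (L : List (ℝ × ℝ × Fin n)) : GT n
  | cut (agent : Fin n) (lo hi : ℝ) (child : ℝ → GT n) : GT n
  | choose (agent : Fin n) (k : ℕ) (children : Fin (k + 1) → GT n) : GT n

/-- Playing an abstract game tree. -/
def GT.play {n : ℕ} : GT n → Hist → (Fin n → BCStrategy) → List (ℝ × ℝ × Fin n)
  | .leaf L, _, _ => L
  | .cut i lo hi child, h, σ =>
      (child (max lo (min ((σ i).cutAt h) hi))).play
        (h ++ [Sum.inl (max lo (min ((σ i).cutAt h) hi))]) σ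
  | .choose i k children, h, σ =>
      (children ⟨(σ i).chooseAt h % (k + 1), Nat.mod_lt _ (Nat.succ_pos k)⟩).play
        (h ++ [Sum.inr ((σ i).chooseAt h % (k + 1))]) σ

/-- The coalition `I` can force the outcome to satisfy `P`. -/
def GT.Win {n : ℕ} (I : Set (Fin n)) (P : List (ℝ × ℝ × Fin n) → Prop) : GT n → Prop
  | .leaf L => P L
  | .cut i lo hi child =>
      (i ∈ I → ∃ x : ℝ, (child (max lo (min x hi))).Win I P) ∧
      (i ∉ I → ∀ x : ℝ, (child (max lo (min x hi))).Win I P)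
  | .choose i _ children =>
      (i ∈ I → ∃ t, (children t).Win I P) ∧ (i ∉ I → ∀ t, (children t).Win I P)

theorem GT.play_congr {n : ℕ} (g : GT n) : ∀ (h : Hist) (σ σ' : Fin n → BCStrategy),
    (∀ i h', h <+: h' → (σ i).cutAt h' = (σ' i).cutAt h' ∧
      (σ i).chooseAt h' = (σ' i).chooseAt h') → g.play h σ = g.play h σ' := by
  induction g with
  | leaf L => intros; rfl
  | cut i lo hi child ih =>
    intro h σ σ' H
    simp only [GT.play]
    rw [(H i h (List.prefix_refl _)).1]
    apply ih
    intro i h' hh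
    exact H i h' ((List.prefix_append _ _).trans hh)
  | choose i k children ih =>
    intro h σ σ' H
    simp only [GT.play]
    simp only [(H i h (List.prefix_refl _)).2]
    apply ih
    intro i h' hh
    exact H i h' ((List.prefix_append _ _).trans hh)

theorem not_prefix_of_snoc (h : Hist) (z : ℝ ⊕ ℕ) (h' : Hist) (hh : h ++ [z] <+: h') :
    h' ≠ h := by
  rintro rfl
  have := hh.length_le
  simp at this

open Classical in
/-- Change the answers of agent `i` at history `h`. -/
noncomputable def setAt {n : ℕ} (σ : Fin n → BCStrategy) (i : Fin n) (h : Hist) (x : ℝ) (k : ℕ) :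
    Fin n → BCStrategy := fun j =>
  { cutAt := fun h' => if j = i ∧ h' = h then x else (σ j).cutAt h'
    chooseAt := fun h' => if j = i ∧ h' = h then k else (σ j).chooseAt h' }

theorem setAt_play {n : ℕ} (g : GT n) (σ : Fin n → BCStrategy) (i : Fin n) (h : Hist) (x : ℝ)
    (k : ℕ) (z : ℝ ⊕ ℕ) : g.play (h ++ [z]) (setAt σ i h x k) = g.play (h ++ [z]) σ := by
  apply GT.play_congr
  intro j h' hh
  have := not_prefix_of_snoc h z h' hh
  simp [setAt, this]

theorem setAt_ne {n : ℕ} (σ : Fin n → BCStrategy) (i j : Fin n) (hij : j ≠ i) (h : Hist) (x : ℝ)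
    (k : ℕ) : setAt σ i h x k j = σ j := by
  simp [setAt, hij]

/-- The coalition version of a strategy guarantee at a node reached with history `h`. -/
def GT.Guar {n : ℕ} (I : Set (Fin n)) (P : List (ℝ × ℝ × Fin n) → Prop) (g : GT n) (h : Hist)
    (s : Fin n → BCStrategy) : Prop :=
  ∀ σ : Fin n → BCStrategy, (∀ i ∈ I, σ i = s i) → P (g.play h σ)

theorem GT.win_of_guar {n : ℕ} (I : Set (Fin n)) (P : List (ℝ × ℝ × Fin n) → Prop) (g : GT n) :
    ∀ (h : Hist) (s : Fin n → BCStrategy), g.Guar I P h s → g.Win I P := by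
  induction g with
  | leaf L => intro h s H; exact H s (fun _ _ => rfl)
  | cut i lo hi child ih =>
    intro h s H
    refine ⟨fun hi' => ⟨(s i).cutAt h, ?_⟩, fun hi' x => ?_⟩
    · apply ih _ (h ++ [Sum.inl (max lo (min ((s i).cutAt h) hi))]) s
      intro σ hσ
      have := H σ hσ
      simpa only [GT.play, hσ i hi'] using this
    · apply ih _ (h ++ [Sum.inl (max lo (min x hi))]) s
      intro σ hσ
      have := H (setAt σ i h x 0) (fun j hj => by
        rw [setAt_ne _ _ _ (by rintro rfl; exact hi' hj)]; exact hσ j hj)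
      simp only [GT.play, setAt_play] at this
      simpa [setAt] using this
  | choose i k children ih =>
    intro h s H
    refine ⟨fun hi' => ⟨⟨(s i).chooseAt h % (k + 1), Nat.mod_lt _ (Nat.succ_pos k)⟩, ?_⟩,
      fun hi' t => ?_⟩
    · apply ih _ (h ++ [Sum.inr ((s i).chooseAt h % (k + 1))]) s
      intro σ hσ
      have := H σ hσ
      simpa only [GT.play, hσ i hi'] using this
    · apply ih _ (h ++ [Sum.inr (t : ℕ)]) s
      intro σ hσ
      have := H (setAt σ i h 0 t) (fun j hj => by
        rw [setAt_ne _ _ _ (by rintro rfl; exact hi' hj)]; exact hσ j hj)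
      simp only [GT.play, setAt_play] at this
      simpa [setAt, Nat.mod_eq_of_lt t.isLt] using this

theorem GT.guar_congr {n : ℕ} (I : Set (Fin n)) (P : List (ℝ × ℝ × Fin n) → Prop) (g : GT n)
    (h : Hist) (s s' : Fin n → BCStrategy)
    (H : ∀ i h', h <+: h' → (s i).cutAt h' = (s' i).cutAt h' ∧
      (s i).chooseAt h' = (s' i).chooseAt h') (hg : g.Guar I P h s) : g.Guar I P h s' := by
  classical
  intro σ hσ
  have := hg (fun i => if i ∈ I then s i else σ i) (fun i hi => by simp [hi])
  rw [GT.play_congr g h _ σ] at this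
  · exact this
  · intro i h' hh
    by_cases hi : i ∈ I
    · simp only [hi, if_true, hσ i hi]; exact H i h' hh
    · simp [hi]

theorem GT.guar_of_win {n : ℕ} (I : Set (Fin n)) (P : List (ℝ × ℝ × Fin n) → Prop) (g : GT n) :
    ∀ (h : Hist), g.Win I P → ∃ s, g.Guar I P h s := by
  induction g with
  | leaf L =>
    intro h H
    exact ⟨fun _ => ⟨fun _ => 0, fun _ => 0⟩, fun _ _ => H⟩
  | cut i lo hi child ih =>
    intro h H
    by_cases hi' : i ∈ I
    · obtain ⟨x, hx⟩ := H.1 hi'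
      obtain ⟨s, hs⟩ := ih _ (h ++ [Sum.inl (max lo (min x hi))]) hx
      refine ⟨setAt s i h x 0, fun σ hσ => ?_⟩
      have e : (σ i).cutAt h = x := by rw [hσ i hi']; simp [setAt]
      simp only [GT.play, e]
      refine GT.guar_congr I P _ _ s (setAt s i h x 0) ?_ hs σ hσ
      intro j h' hh
      have := not_prefix_of_snoc _ _ _ hh
      simp [setAt, this]
    · have H2 := H.2 hi'
      choose s hs using fun x => ih _ (h ++ [Sum.inl (max lo (min x hi))]) (H2 x)
      refine ⟨fun j => ⟨fun h' => match h'[h.length]? with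
          | some (Sum.inl y) => (s y j).cutAt h'
          | _ => 0, fun h' => match h'[h.length]? with
          | some (Sum.inl y) => (s y j).chooseAt h'
          | _ => 0⟩, fun σ hσ => ?_⟩
      have hcl : ∀ x : ℝ, max lo (min (max lo (min x hi)) hi) = max lo (min x hi) := by
        intro x
        rcases le_total lo hi with h1 | h1
        · rw [min_eq_left (max_le h1 (min_le_right _ _))]; simp
        · rw [max_eq_left ((min_le_right _ _).trans h1), max_eq_left ((min_le_right _ _).trans h1)]
      have hs' := hs (max lo (min ((σ i).cutAt h) hi))
      rw [hcl] at hs'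
      simp only [GT.play]
      refine GT.guar_congr I P _ _ _ _ ?_ hs' σ hσ
      rintro j h' ⟨r, rfl⟩
      simp
  | choose i k children ih =>
    intro h H
    by_cases hi' : i ∈ I
    · obtain ⟨t, ht⟩ := H.1 hi'
      obtain ⟨s, hs⟩ := ih _ (h ++ [Sum.inr (t : ℕ)]) ht
      refine ⟨setAt s i h 0 t, fun σ hσ => ?_⟩
      have e : (σ i).chooseAt h = t := by rw [hσ i hi']; simp [setAt]
      simp only [GT.play, e, Nat.mod_eq_of_lt t.isLt]
      refine GT.guar_congr I P _ _ s (setAt s i h 0 t) ?_ hs σ hσ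
      intro j h' hh
      have := not_prefix_of_snoc _ _ _ hh
      simp [setAt, this]
    · have H2 := H.2 hi'
      choose s hs using fun t => ih t (h ++ [Sum.inr (t : ℕ)]) (H2 t)
      refine ⟨fun j => ⟨fun h' => match h'[h.length]? with
          | some (Sum.inr y) => (s (Fin.ofNat (k + 1) y) j).cutAt h'
          | _ => 0, fun h' => match h'[h.length]? with
          | some (Sum.inr y) => (s (Fin.ofNat (k + 1) y) j).chooseAt h'
          | _ => 0⟩, fun σ hσ => ?_⟩
      have hs' := hs ⟨(σ i).chooseAt h % (k + 1), Nat.mod_lt _ (Nat.succ_pos k)⟩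
      simp only [GT.play]
      refine GT.guar_congr I P _ _ _ _ ?_ hs' σ hσ
      rintro j h' ⟨r, rfl⟩
      have : Fin.ofNat (k + 1) ((σ i).chooseAt h % (k + 1)) =
          ⟨(σ i).chooseAt h % (k + 1), Nat.mod_lt _ (Nat.succ_pos k)⟩ := by
        apply Fin.ext; simp [Fin.ofNat]
      have e : (h ++ [Sum.inr ((σ i).chooseAt h % (k + 1))] ++ r)[h.length]? =
          some (Sum.inr ((σ i).chooseAt h % (k + 1))) := by simp
      simp only [e, this, and_self]

/-! ## Embedding both kinds of trees -/

/-- The abstract game tree of a BC tree. -/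
def BCTree.toGT {n : ℕ} : {m : ℕ} → BCTree n m → (Fin (m + 2) → ℝ) → GT n
  | m, .leaf alloc, c =>
      .leaf ((List.finRange (m + 1)).map fun t => (c t.castSucc, c t.succ, alloc t))
  | _, .cut i j child, c =>
      .cut i (c j.castSucc) (c j.succ) fun y => child.toGT (insertPt c j y)
  | _, @BCTree.choose _ _ i k children, c => .choose i k fun t => (children t).toGT c

/-- The abstract game tree of an extended BC tree. -/
def ExtTree.toGT {n : ℕ} : {m : ℕ} → ExtTree n m → (Fin (m + 2) → ℝ) → GT n
  | _, .leaf alloc, p => .leaf (alloc.map fun q => (p q.1, p q.2.1, q.2.2))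
  | _, .cut i a b child, p =>
      .cut i (min (p a) (p b)) (max (p a) (p b)) fun y => child.toGT (extendPt p y)
  | _, @ExtTree.choose _ _ i k children, p => .choose i k fun t => (children t).toGT p

theorem BCTree.play_toGT {n m : ℕ} (t : BCTree n m) : ∀ c h σ,
    t.playAlloc c h σ = (t.toGT c).play h σ := by
  induction t with
  | leaf alloc => intros; rfl
  | cut i j child ih => intro c h σ; simp only [BCTree.playAlloc, BCTree.toGT, GT.play, ih]
  | choose i children ih => intro c h σ; simp only [BCTree.playAlloc, BCTree.toGT, GT.play, ih]

theorem ExtTree.play_toGT {n m : ℕ} (t : ExtTree n m) : ∀ c h σ,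
    t.playAlloc c h σ = (t.toGT c).play h σ := by
  induction t with
  | leaf alloc => intros; rfl
  | cut i a b child ih => intro c h σ; simp only [ExtTree.playAlloc, ExtTree.toGT, GT.play, ih]
  | choose i children ih => intro c h σ; simp only [ExtTree.playAlloc, ExtTree.toGT, GT.play, ih]

/-- Sorted partitions of the cake. -/
def GoodPts {m : ℕ} (c : Fin (m + 2) → ℝ) : Prop :=
  Monotone c ∧ c 0 = 0 ∧ c (Fin.last (m + 1)) = 1

/-- Position of the new point. -/
def newPos {m : ℕ} (j : Fin (m + 1)) : Fin (m + 3) := j.succ.castSucc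

theorem insertPt_eq {m : ℕ} (c : Fin (m + 2) → ℝ) (j : Fin (m + 1)) (y : ℝ) :
    insertPt c j y = (newPos j).insertNth (α := fun _ => ℝ) y c := by
  rw [Fin.eq_insertNth_iff]
  constructor
  · simp [insertPt, newPos]
  · funext t
    show insertPt c j y ((newPos j).succAbove t) = c t
    rcases lt_or_ge t.castSucc (newPos j) with h | h
    · rw [Fin.succAbove_of_castSucc_lt _ _ h]
      simp only [newPos, Fin.lt_def, Fin.val_castSucc, Fin.val_succ] at h
      unfold insertPt
      rw [dif_pos (by simp only [Fin.val_castSucc]; omega)]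
      rfl
    · rw [Fin.succAbove_of_le_castSucc _ _ h]
      simp only [newPos, Fin.le_def, Fin.val_castSucc, Fin.val_succ] at h
      unfold insertPt
      rw [dif_neg (by simp only [Fin.val_succ]; omega), if_neg (by simp only [Fin.val_succ]; omega)]
      rfl

theorem extendPt_eq {m : ℕ} (p : Fin (m + 2) → ℝ) (y : ℝ) :
    extendPt p y = Fin.snoc (α := fun _ => ℝ) p y := by
  funext t
  refine Fin.lastCases ?_ (fun t => ?_) t
  · simp [extendPt]
  · simp [extendPt]

theorem insertPt_good {m : ℕ} (c : Fin (m + 2) → ℝ) (hc : GoodPts c) (j : Fin (m + 1)) (y : ℝ)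
    (h1 : c j.castSucc ≤ y) (h2 : y ≤ c j.succ) : GoodPts (insertPt c j y) := by
  obtain ⟨hm, h0, hl⟩ := hc
  refine ⟨?_, ?_, ?_⟩
  · apply Fin.monotone_iff_le_succ.2
    intro t
    have ht := t.isLt
    have hj := j.isLt
    simp only [insertPt, Fin.val_castSucc, Fin.val_succ]
    split_ifs
    · apply hm; simp [Fin.le_def]
    · refine le_trans (hm ?_) h1; simp only [Fin.le_def, Fin.val_castSucc]; omega
    · omega
    · omega
    · omega
    · refine h2.trans (hm ?_); simp only [Fin.le_def, Fin.val_succ]; omega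
    · omega
    · omega
    · apply hm; simp [Fin.le_def]
  · simpa [insertPt] using h0
  · have hj := j.isLt
    simp only [insertPt, Fin.val_last]
    rw [dif_neg (by omega), if_neg (by omega)]
    exact hl

theorem initPts_good : GoodPts (m := 0) initPts := by
  refine ⟨?_, by simp [initPts], by simp [initPts]⟩
  apply Fin.monotone_iff_le_succ.2
  intro t
  fin_cases t
  simp [initPts]

/-! ## BC trees are extended BC trees -/

/-- Translate a BC tree, where `ψ` gives the creation index of each sorted position. -/
def BCTree.toExt {n : ℕ} : {m : ℕ} → BCTree n m → (Fin (m + 2) → Fin (m + 2)) → ExtTree n m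
  | m, .leaf alloc, ψ =>
      .leaf ((List.finRange (m + 1)).map fun t => (ψ t.castSucc, ψ t.succ, alloc t))
  | m, .cut i j child, ψ => .cut i (ψ j.castSucc) (ψ j.succ)
      (child.toExt ((newPos j).insertNth (α := fun _ => Fin (m + 3)) (Fin.last (m + 2))
        (Fin.castSucc ∘ ψ)))
  | _, @BCTree.choose _ _ i _ children, ψ => .choose i fun t => (children t).toExt ψ

theorem BCTree.toExt_play {n m : ℕ} (t : BCTree n m) : ∀ ψ p h σ, GoodPts (p ∘ ψ) →
    (t.toExt ψ).playAlloc p h σ = t.playAlloc (p ∘ ψ) h σ := by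
  induction t with
  | leaf alloc => intro ψ p h σ _; simp [BCTree.toExt, BCTree.playAlloc, ExtTree.playAlloc]
  | cut i j child ih =>
    intro ψ p h σ hc
    have hle : p (ψ j.castSucc) ≤ p (ψ j.succ) :=
      hc.1 (by simp [Fin.le_def])
    have e : ∀ y, extendPt p y ∘ (newPos j).insertNth (α := fun _ => Fin _) (Fin.last _)
        (Fin.castSucc ∘ ψ) = insertPt (p ∘ ψ) j y := by
      intro y
      rw [insertPt_eq, extendPt_eq, Fin.eq_insertNth_iff]
      constructor
      · simp
      · funext t; simp [Fin.removeNth]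
    simp only [BCTree.toExt, BCTree.playAlloc, ExtTree.playAlloc, min_eq_left hle, max_eq_right hle,
      Function.comp]
    rw [ih, e]
    · rw [e]
      apply insertPt_good _ hc
      · exact le_max_left _ _
      · exact max_le hle (min_le_right _ _)
  | choose i children ih =>
    intro ψ p h σ hc
    simp only [BCTree.toExt, BCTree.playAlloc, ExtTree.playAlloc]
    rw [ih _ _ _ _ _ hc]

theorem BCTree.partitions {n m : ℕ} (t : BCTree n m) : ∀ c h σ, GoodPts c →
    PartitionsCake (t.playAlloc c h σ) := by
  induction t with
  | @leaf m alloc =>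
    intro c h σ hc
    refine ⟨_, List.Perm.refl _, ?_, ?_, ?_, ?_⟩
    · intro q hq
      simp only [BCTree.playAlloc, List.mem_map] at hq
      obtain ⟨t, -, rfl⟩ := hq
      exact hc.1 (by simp [Fin.le_def])
    · show List.IsChain _ _
      rw [List.isChain_iff_getElem]
      intro i hi
      simp only [BCTree.playAlloc, List.getElem_map, List.getElem_finRange]
      rfl
    · simp only [BCTree.playAlloc, List.finRange_succ]
      simpa using hc.2.1
    · simp only [BCTree.playAlloc, List.finRange_succ_last]
      simpa using hc.2.2
  | cut i j child ih =>
    intro c h σ hc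
    simp only [BCTree.playAlloc]
    apply ih
    apply insertPt_good _ hc
    · exact le_max_left _ _
    · exact max_le (hc.1 (by simp [Fin.le_def])) (min_le_right _ _)
  | choose i children ih =>
    intro c h σ hc
    simp only [BCTree.playAlloc]
    exact ih _ _ _ _ hc

/-! ## From extended BC trees to BC trees -/

theorem pieceValue_allocOf {n : ℕ} (V : CakeValuation) (L : List (ℝ × ℝ × Fin n)) (a : Fin n) :
    pieceValue V (allocOf L a) =
      (L.map fun q => if q.2.2 = a then V.v q.1 q.2.1 else 0).sum := by
  induction L with
  | nil => simp [pieceValue, allocOf]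
  | cons q L ih =>
    simp only [pieceValue, allocOf, List.map_map] at ih ⊢
    by_cases h : q.2.2 = a
    · simp [h, ih]
    · simp [h, ih]

/-- The list of intervals (with natural number endpoints) is chained from `s` to `e`. -/
def ChainFromTo {n : ℕ} : ℕ → ℕ → List (ℕ × ℕ × Fin n) → Prop
  | s, e, [] => s = e
  | s, e, q :: Q => q.1 = s ∧ q.1 ≤ q.2.1 ∧ ChainFromTo q.2.1 e Q

theorem ChainFromTo.le {n : ℕ} (Q : List (ℕ × ℕ × Fin n)) : ∀ s e, ChainFromTo s e Q → s ≤ e := by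
  induction Q with
  | nil => intro s e h; exact le_of_eq h
  | cons q Q ih => rintro s e ⟨rfl, h2, h3⟩; exact h2.trans (ih _ _ h3)

theorem additive_sum (w : ℕ → ℕ → ℝ) (hw : ∀ x y z, x ≤ y → y ≤ z → w x y + w y z = w x z)
    (s e : ℕ) (h : s ≤ e) : ∑ t ∈ Finset.Ico s e, w t (t + 1) = w s e := by
  induction e, h using Nat.le_induction with
  | base => have := hw s s s le_rfl le_rfl; simp; linarith
  | succ e h ih => rw [Finset.sum_Ico_succ_top h, ih, hw _ _ _ h (Nat.le_succ e)]

theorem exists_owner {n : ℕ} (d : Fin n) (Q : List (ℕ × ℕ × Fin n)) : ∀ s e, ChainFromTo s e Q →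
    ∃ owner : ℕ → Fin n, ∀ w : ℕ → ℕ → ℝ,
      (∀ x y z, x ≤ y → y ≤ z → w x y + w y z = w x z) → ∀ a,
      ∑ t ∈ Finset.Ico s e, (if owner t = a then w t (t + 1) else 0) =
        (Q.map fun q => if q.2.2 = a then w q.1 q.2.1 else 0).sum := by
  induction Q with
  | nil =>
    rintro s e h
    obtain rfl : s = e := h
    exact ⟨fun _ => d, by intros; simp⟩
  | cons q Q ih =>
    rintro s e ⟨rfl, h2, h3⟩
    obtain ⟨o, ho⟩ := ih _ _ h3
    refine ⟨fun t => if t < q.2.1 then q.2.2 else o t, fun w hw a => ?_⟩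
    rw [← Finset.sum_Ico_consecutive _ h2 (ChainFromTo.le _ _ _ h3), List.map_cons, List.sum_cons,
      ← ho w hw a]
    congr 1
    · rw [← additive_sum w hw _ _ h2]
      by_cases hq : q.2.2 = a
      · rw [if_pos hq]
        apply Finset.sum_congr rfl
        intro t ht
        simp [(Finset.mem_Ico.1 ht).2, hq]
      · rw [if_neg hq]
        apply Finset.sum_eq_zero
        intro t ht
        simp [(Finset.mem_Ico.1 ht).2, hq]
    · apply Finset.sum_congr rfl
      intro t ht
      simp [not_lt.2 (Finset.mem_Ico.1 ht).1]

/-- Predicates on outcomes only depending on the values of the pieces. -/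
def Resp {n : ℕ} (V : CakeValuation) (P : List (ℝ × ℝ × Fin n) → Prop) : Prop :=
  ∀ L L', (∀ a, pieceValue V (allocOf L a) = pieceValue V (allocOf L' a)) → (P L ↔ P L')

theorem chain_of_lists {α : Type*} {n : ℕ} (f g : α → ℕ) (ag : α → Fin n) (A : List α) :
    ∀ s e : ℕ, (∀ q ∈ A, f q ≤ g q) → List.IsChain (fun q r => g q = f r) A →
    (A.head?.map f) = some s → (A.getLast?.map g) = some e →
    ChainFromTo s e (A.map fun q => (f q, g q, ag q)) := by
  induction A with
  | nil => intro s e _ _ h; simp at h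
  | cons q A ih =>
    intro s e h1 h2 h3 h4
    refine ⟨by simpa using h3, h1 q (by simp), ?_⟩
    cases A with
    | nil => simpa [ChainFromTo] using h4
    | cons r A =>
      apply ih
      · intro q hq; exact h1 q (List.mem_cons_of_mem _ hq)
      · exact h2.tail
      · rw [List.isChain_cons_cons] at h2
        simp [h2.1]
      · simpa using h4

theorem leaf_case {n m m' : ℕ} (alloc : List (Fin (m + 2) × Fin (m + 2) × Fin n))
    (φ : Fin (m + 2) → Fin (m' + 2))
    (H : ∀ c : Fin (m' + 2) → ℝ, GoodPts c →
      PartitionsCake (alloc.map fun q => (c (φ q.1), c (φ q.2.1), q.2.2))) :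
    ∃ o : Fin (m' + 1) → Fin n, ∀ c : Fin (m' + 2) → ℝ, GoodPts c → ∀ V a,
      pieceValue V (allocOf (alloc.map fun q => (c (φ q.1), c (φ q.2.1), q.2.2)) a) =
      pieceValue V (allocOf ((List.finRange (m' + 1)).map
        fun t => (c t.castSucc, c t.succ, o t)) a) := by
  let c0 : Fin (m' + 2) → ℝ := fun t => (t : ℕ) / ((m' : ℝ) + 1)
  have hpos : (0 : ℝ) < (m' : ℝ) + 1 := by positivity
  have c0le : ∀ s t, c0 s ≤ c0 t ↔ (s : ℕ) ≤ t := by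
    intro s t
    simp only [c0]
    rw [div_le_div_iff_of_pos_right hpos]
    exact Nat.cast_le
  have c0inj : ∀ s t, c0 s = c0 t ↔ (s : ℕ) = t := by
    intro s t
    rw [le_antisymm_iff, c0le, c0le, ← le_antisymm_iff]
  have g0 : GoodPts c0 := by
    refine ⟨fun s t h => (c0le s t).2 h, by simp [c0], ?_⟩
    simp only [c0, Fin.val_last]
    push_cast
    exact div_self hpos.ne'
  obtain ⟨L', hp, h1, h2, h3, h4⟩ := H c0 g0
  have : Relation.Comp (· = List.map (fun q : Fin (m + 2) × Fin (m + 2) × Fin n =>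
      (c0 (φ q.1), c0 (φ q.2.1), q.2.2)) ·) (List.Perm · ·) L' alloc := by
    rw [List.eq_map_comp_perm]; exact hp
  obtain ⟨A, rfl, hA⟩ := this
  have hch := chain_of_lists (fun q : Fin (m + 2) × Fin (m + 2) × Fin n => ((φ q.1 : Fin _) : ℕ))
    (fun q => ((φ q.2.1 : Fin _) : ℕ)) (fun q => q.2.2) A 0 (m' + 1)
    (fun q hq => (c0le _ _).1 (h1 _ (List.mem_map_of_mem hq)))
    (by
      have h2' := (List.isChain_map _).1 h2
      exact h2'.imp fun q r h => (c0inj _ _).1 h)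
    (by
      cases A with
      | nil => simp at h3
      | cons q A =>
        have h3' : c0 (φ q.1) = 0 := by simpa using h3
        rw [← g0.2.1, c0inj] at h3'
        simpa using h3')
    (by
      rw [List.getLast?_map, Option.map_map] at h4
      cases hl : A.getLast? with
      | none => simp [hl] at h4
      | some q =>
        have h4' : c0 (φ q.2.1) = 1 := by simpa [hl] using h4
        rw [← g0.2.2, c0inj] at h4'
        simpa using h4')
  have hne : A ≠ [] := by rintro rfl; simp at h3
  obtain ⟨d, -⟩ := List.exists_mem_of_ne_nil A hne
  obtain ⟨o, ho⟩ := exists_owner d.2.2 _ _ _ hch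
  refine ⟨fun t => o t, fun c hc V a => ?_⟩
  let C : ℕ → ℝ := fun x => c (Fin.ofNat (m' + 2) (min x (m' + 1)))
  have hCv : ∀ t : Fin (m' + 2), C t = c t := by
    intro t
    simp only [C]
    congr 1
    apply Fin.ext
    have := t.isLt
    simp only [Fin.ofNat]
    rw [Nat.mod_eq_of_lt (by omega)]
    omega
  have hCm : Monotone C := by
    intro x y hxy
    apply hc.1
    simp only [Fin.le_def, Fin.ofNat]
    rw [Nat.mod_eq_of_lt (by omega), Nat.mod_eq_of_lt (by omega)]
    omega
  have hC0 : ∀ x, 0 ≤ C x := fun x => by rw [← hc.2.1]; exact hc.1 (Fin.zero_le _)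
  have hC1 : ∀ x, C x ≤ 1 := fun x => by rw [← hc.2.2]; exact hc.1 (Fin.le_last _)
  have key := ho (fun x y => V.v (C x) (C y)) (fun x y z hxy hyz =>
    V.additive _ _ _ (hC0 _) (hCm hxy) (hCm hyz) (hC1 _)) a
  rw [pieceValue_allocOf, pieceValue_allocOf]
  have e1 : (List.map (fun q : ℝ × ℝ × Fin n => if q.2.2 = a then V.v q.1 q.2.1 else 0)
      (alloc.map fun q => (c (φ q.1), c (φ q.2.1), q.2.2))).sum =
      (List.map (fun q : ℝ × ℝ × Fin n => if q.2.2 = a then V.v q.1 q.2.1 else 0)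
      (A.map fun q => (c (φ q.1), c (φ q.2.1), q.2.2))).sum :=
    (((hA.map _).map _).sum_eq).symm
  rw [e1]
  simp only [List.map_map, Function.comp_def, hCv] at key ⊢
  rw [← key, Nat.Ico_zero_eq_range, Finset.sum_range]
  rw [← List.sum_ofFn, List.ofFn_eq_map]
  congr 2
  funext t
  have ea := hCv t.castSucc
  have eb := hCv t.succ
  simp only [Fin.val_castSucc, Fin.val_succ] at ea eb
  rw [ea, eb]

theorem comp_new {m m' : ℕ} (φ : Fin (m + 2) → Fin (m' + 2)) (j : Fin (m' + 1))
    (c : Fin (m' + 2) → ℝ) (y : ℝ) :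
    insertPt c j y ∘ Fin.snoc (α := fun _ => Fin (m' + 3)) ((newPos j).succAbove ∘ φ) (newPos j) =
      extendPt (c ∘ φ) y := by
  rw [insertPt_eq, extendPt_eq]
  funext t
  refine Fin.lastCases ?_ (fun t => ?_) t
  · simp
  · simp

theorem comp_old {m m' : ℕ} (φ : Fin (m + 2) → Fin (m' + 2)) (l : Fin (m' + 2))
    (c : Fin (m' + 2) → ℝ) :
    c ∘ Fin.snoc (α := fun _ => Fin (m' + 2)) φ l = extendPt (c ∘ φ) (c l) := by
  rw [extendPt_eq]
  funext t
  refine Fin.lastCases ?_ (fun t => ?_) t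
  · simp
  · simp

/-- Every good refined partition comes from inserting a point. -/
theorem exists_insert {m : ℕ} (c' : Fin (m + 3) → ℝ) (hc : GoodPts c') (j : Fin (m + 1)) :
    ∃ c y, GoodPts c ∧ c j.castSucc ≤ y ∧ y ≤ c j.succ ∧ c' = insertPt c j y := by
  have hs1 : (newPos j).succAbove j.castSucc = j.castSucc.castSucc :=
    Fin.succAbove_of_castSucc_lt _ _ (by simp [newPos, Fin.lt_def])
  have hs2 : (newPos j).succAbove j.succ = j.succ.succ :=
    Fin.succAbove_of_le_castSucc _ _ (by simp [newPos, Fin.le_def])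
  refine ⟨c' ∘ (newPos j).succAbove, c' (newPos j), ⟨?_, ?_, ?_⟩, ?_, ?_, ?_⟩
  · exact hc.1.comp (Fin.strictMono_succAbove _).monotone
  · have : (newPos j).succAbove 0 = 0 :=
      Fin.succAbove_of_castSucc_lt _ _ (by simp [newPos, Fin.lt_def])
    simp [this, hc.2.1]
  · have : (newPos j).succAbove (Fin.last _) = Fin.last _ := by
      rw [Fin.succAbove_of_le_castSucc _ _ (by
        have := j.isLt
        simp only [newPos, Fin.le_def, Fin.val_castSucc, Fin.val_succ, Fin.val_last]
        omega)]
      rfl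
    simp [this, hc.2.2]
  · simp only [Function.comp, hs1]
    exact hc.1 (by simp [newPos, Fin.le_def])
  · simp only [Function.comp, hs2]
    exact hc.1 (by simp [newPos, Fin.le_def])
  · rw [insertPt_eq, Fin.eq_insertNth_iff]
    exact ⟨rfl, rfl⟩

theorem exists_clamp {lo hi : ℝ} (h : lo ≤ hi) (Q : ℝ → Prop) :
    (∃ x, Q (max lo (min x hi))) ↔ ∃ y, lo ≤ y ∧ y ≤ hi ∧ Q y := by
  constructor
  · rintro ⟨x, hx⟩
    exact ⟨_, le_max_left _ _, max_le h (min_le_right _ _), hx⟩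
  · rintro ⟨y, h1, h2, hy⟩
    exact ⟨y, by rwa [min_eq_left h2, max_eq_right h1]⟩

theorem forall_clamp {lo hi : ℝ} (h : lo ≤ hi) (Q : ℝ → Prop) :
    (∀ x, Q (max lo (min x hi))) ↔ ∀ y, lo ≤ y → y ≤ hi → Q y := by
  constructor
  · intro H y h1 h2
    have := H y
    rwa [min_eq_left h2, max_eq_right h1] at this
  · intro H x
    exact H _ (le_max_left _ _) (max_le h (min_le_right _ _))

/-- Any point between the positions `l` and `l + k + 1` lies in one of the pieces between them. -/
theorem exists_piece (C : ℕ → ℝ) (l k : ℕ) (y : ℝ) (h1 : C l ≤ y) (h2 : y ≤ C (l + k + 1)) :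
    ∃ s, s < k + 1 ∧ C (l + s) ≤ y ∧ y ≤ C (l + s + 1) := by
  induction k with
  | zero => exact ⟨0, by omega, h1, h2⟩
  | succ k ih =>
    rcases le_total y (C (l + k + 1)) with h | h
    · obtain ⟨s, hs, h⟩ := ih h
      exact ⟨s, by omega, h⟩
    · exact ⟨k + 1, by omega, h, h2⟩

theorem ext_to_bc {n m : ℕ} (t : ExtTree n m) : ∀ (m' : ℕ) (φ : Fin (m + 2) → Fin (m' + 2)),
    (∀ c, GoodPts c → (t.toGT (c ∘ φ)).Win ∅ PartitionsCake) →
    ∃ B : BCTree n m', ∀ c, GoodPts c → ∀ V P, Resp V P → ∀ I,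
      ((t.toGT (c ∘ φ)).Win I P ↔ (B.toGT c).Win I P) := by
  induction t with
  | leaf alloc =>
    intro m' φ H
    obtain ⟨o, ho⟩ := leaf_case alloc φ H
    exact ⟨.leaf o, fun c hc V P hP I => hP _ _ (fun a => ho c hc V a)⟩
  | choose i children ih =>
    intro m' φ H
    choose B hB using fun t => ih t m' φ (fun c hc => (H c hc).2 (by simp) t)
    refine ⟨.choose i B, fun c hc V P hP I => ?_⟩
    simp only [ExtTree.toGT, BCTree.toGT, GT.Win, hB _ c hc V P hP I]
  | cut i a b child ih =>
    intro m' φ H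
    -- the lower and the upper end of the cut range
    obtain ⟨l, u, hlu, hmin, hmax⟩ : ∃ l u : Fin (m' + 2), l ≤ u ∧
        (∀ c : Fin (m' + 2) → ℝ, Monotone c → min (c (φ a)) (c (φ b)) = c l) ∧
        (∀ c : Fin (m' + 2) → ℝ, Monotone c → max (c (φ a)) (c (φ b)) = c u) :=
      ⟨min (φ a) (φ b), max (φ a) (φ b), min_le_max, fun c hc => hc.map_min.symm,
        fun c hc => hc.map_max.symm⟩
    have hE : ∀ c, GoodPts c → ∀ I P, ((ExtTree.cut i a b child).toGT (c ∘ φ)).Win I P ↔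
        ((i ∈ I → ∃ y, c l ≤ y ∧ y ≤ c u ∧ (child.toGT (extendPt (c ∘ φ) y)).Win I P) ∧
        (i ∉ I → ∀ y, c l ≤ y → y ≤ c u → (child.toGT (extendPt (c ∘ φ) y)).Win I P)) := by
      intro c hc I P
      simp only [ExtTree.toGT, GT.Win, Function.comp, hmin c hc.1, hmax c hc.1]
      rw [exists_clamp (hc.1 hlu) fun y => (child.toGT (extendPt (c ∘ φ) y)).Win I P,
        forall_clamp (hc.1 hlu) fun y => (child.toGT (extendPt (c ∘ φ) y)).Win I P]
    have H' : ∀ c, GoodPts c → ∀ y, c l ≤ y → y ≤ c u →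
        (child.toGT (extendPt (c ∘ φ) y)).Win ∅ PartitionsCake :=
      fun c hc => ((hE c hc _ _).1 (H c hc)).2 (by simp)
    rcases eq_or_lt_of_le hlu with rfl | hlt
    · obtain ⟨B, hB⟩ := ih m' (Fin.snoc (α := fun _ => Fin (m' + 2)) φ l) (fun c hc => by
        rw [comp_old]; exact H' c hc _ le_rfl le_rfl)
      refine ⟨B, fun c hc V P hP I => ?_⟩
      rw [hE c hc, ← hB c hc V P hP I, comp_old]
      constructor
      · rintro ⟨h1, h2⟩
        by_cases hi : i ∈ I
        · obtain ⟨y, ha, hb, hy⟩ := h1 hi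
          rwa [le_antisymm hb ha] at hy
        · exact h2 hi _ le_rfl le_rfl
      · intro h
        exact ⟨fun _ => ⟨_, le_rfl, le_rfl, h⟩, fun _ y ha hb => by rwa [le_antisymm hb ha]⟩
    · obtain ⟨k, hk⟩ : ∃ k : ℕ, (u : ℕ) = l + k + 1 :=
        ⟨u - l - 1, by have := Fin.lt_def.1 hlt; omega⟩
      have hu := u.isLt
      let J : Fin (k + 1) → Fin (m' + 1) := fun s => ⟨l + s, by have := s.isLt; omega⟩
      have hJl : ∀ s, l ≤ (J s).castSucc := fun s => by simp [J, Fin.le_def]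
      have hJu : ∀ s, (J s).succ ≤ u := fun s => by
        have := s.isLt
        simp only [J, Fin.le_def, Fin.val_succ]; omega
      choose B hB using fun s : Fin (k + 1) => ih (m' + 1)
        (Fin.snoc (α := fun _ => Fin (m' + 3)) ((newPos (J s)).succAbove ∘ φ) (newPos (J s)))
        (fun c' hc' => by
          obtain ⟨c, y, hc, h1, h2, rfl⟩ := exists_insert c' hc' (J s)
          rw [comp_new]
          exact H' c hc y ((hc.1 (hJl s)).trans h1) (h2.trans (hc.1 (hJu s))))
      refine ⟨.choose i fun s => .cut i (J s) (B s), fun c hc V P hP I => ?_⟩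
      have hB' : ∀ s y, c (J s).castSucc ≤ y → y ≤ c (J s).succ →
          ((child.toGT (extendPt (c ∘ φ) y)).Win I P ↔
            ((B s).toGT (insertPt c (J s) y)).Win I P) := by
        intro s y h1 h2
        rw [← hB s _ (insertPt_good c hc _ y h1 h2) V P hP I, comp_new]
      have hpc : ∀ y, c l ≤ y → y ≤ c u → ∃ s, c (J s).castSucc ≤ y ∧ y ≤ c (J s).succ := by
        intro y h1 h2
        let C : ℕ → ℝ := fun x => if h : x < m' + 2 then c ⟨x, h⟩ else 0
        have hC : ∀ t : Fin (m' + 2), C t = c t := fun t => by simp [C]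
        obtain ⟨s, hs, h3, h4⟩ := exists_piece C l k y (by rwa [hC]) (by rw [← hk, hC]; exact h2)
        refine ⟨⟨s, hs⟩, ?_, ?_⟩
        · rw [← hC]; exact h3
        · rw [← hC]; exact h4
      rw [hE c hc]
      simp only [BCTree.toGT, GT.Win]
      have hle : ∀ s, c (J s).castSucc ≤ c (J s).succ := fun s => hc.1 (by simp [Fin.le_def])
      have hex : ∀ s, (∃ x, ((B s).toGT (insertPt c (J s) (max (c (J s).castSucc)
          (min x (c (J s).succ))))).Win I P) ↔ _ := fun s => exists_clamp (hle s)
            fun y => ((B s).toGT (insertPt c (J s) y)).Win I P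
      have hall : ∀ s, (∀ x, ((B s).toGT (insertPt c (J s) (max (c (J s).castSucc)
          (min x (c (J s).succ))))).Win I P) ↔ _ := fun s => forall_clamp (hle s)
            fun y => ((B s).toGT (insertPt c (J s) y)).Win I P
      simp only [hex, hall]
      by_cases hi : i ∈ I
      · simp only [hi, true_implies, not_true, false_implies, and_true]
        constructor
        · rintro ⟨y, h1, h2, hy⟩
          obtain ⟨s, h3, h4⟩ := hpc y h1 h2
          exact ⟨s, y, h3, h4, (hB' s y h3 h4).1 hy⟩
        · rintro ⟨s, y, h3, h4, hy⟩
          exact ⟨y, (hc.1 (hJl s)).trans h3, h4.trans (hc.1 (hJu s)), (hB' s y h3 h4).2 hy⟩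
      · simp only [hi, not_false_eq_true, true_implies, false_implies, true_and]
        constructor
        · intro h s y h3 h4
          exact (hB' s y h3 h4).1 (h y ((hc.1 (hJl s)).trans h3) (h4.trans (hc.1 (hJu s))))
        · intro h y h1 h2
          obtain ⟨s, h3, h4⟩ := hpc y h1 h2
          exact (hB' s y h3 h4).2 (h s y h3 h4)

theorem exists_guar_iff {n : ℕ} (g : GT n) (i : Fin n) (P : List (ℝ × ℝ × Fin n) → Prop) :
    (∃ s : BCStrategy, ∀ σ : Fin n → BCStrategy, σ i = s → P (g.play [] σ)) ↔ g.Win {i} P := by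
  constructor
  · rintro ⟨s, hs⟩
    exact GT.win_of_guar _ _ _ [] (fun _ => s) fun σ hσ => hs σ (hσ i rfl)
  · intro h
    obtain ⟨s, hs⟩ := GT.guar_of_win _ _ _ [] h
    refine ⟨s i, fun σ hσ => hs σ ?_⟩
    rintro j rfl
    exact hσ

/-- **Theorem.** BC protocols and extended BC protocols represent the same class of
protocols up to strong envy-equivalence: every BC protocol is itself an extended BC
protocol (there is an extended BC protocol inducing the very same game), and every
extended BC protocol is strongly envy-equivalent to some BC protocol. -/
theorem bc_and_ext_same_class (n : ℕ) :
    (∀ B : BCTree n 0, ∃ E : ExtProtocol n, E.toGame = B.toGame) ∧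
    (∀ E : ExtProtocol n, ∃ B : BCTree n 0, StronglyEnvyEquiv E.toGame B.toGame) := by
  refine ⟨fun B => ?_, fun E => ?_⟩
  · have hplay : ∀ σ, (B.toExt id).playAlloc initPts [] σ = B.playAlloc initPts [] σ :=
      fun σ => B.toExt_play id initPts [] σ initPts_good
    refine ⟨⟨B.toExt id, fun σ => ?_⟩, ?_⟩
    · rw [hplay]
      exact B.partitions _ _ _ initPts_good
    · simp only [ExtProtocol.toGame, BCTree.toGame, hplay]
  · have hval : (E.tree.toGT initPts).Win ∅ PartitionsCake :=
      GT.win_of_guar _ _ _ [] (fun _ => ⟨fun _ => 0, fun _ => 0⟩) fun σ _ => by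
        rw [← ExtTree.play_toGT]; exact E.valid σ
    have huniq : ∀ c : Fin (0 + 2) → ℝ, GoodPts c → c = initPts := by
      intro c hc
      funext t
      fin_cases t
      · simpa [initPts] using hc.2.1
      · simpa [initPts] using hc.2.2
    obtain ⟨B, hB⟩ := ext_to_bc E.tree 0 id (fun c hc => by rw [huniq c hc]; exact hval)
    refine ⟨B, fun i S _ M _ V => ?_⟩
    have hP : Resp V (fun L : List (ℝ × ℝ × Fin n) => ∀ j ∈ S, envy V (allocOf L) i j ≤ M j) := by
      intro L L' h
      simp only [envy, h]
    have h1 := exists_guar_iff (E.tree.toGT initPts) i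
      (fun L : List (ℝ × ℝ × Fin n) => ∀ j ∈ S, envy V (allocOf L) i j ≤ M j)
    have h2 := exists_guar_iff (B.toGT initPts) i
      (fun L : List (ℝ × ℝ × Fin n) => ∀ j ∈ S, envy V (allocOf L) i j ≤ M j)
    have h3 := hB initPts initPts_good V _ hP {i}
    simp only [← ExtTree.play_toGT] at h1
    simp only [← BCTree.play_toGT] at h2
    exact h1.trans (h3.trans h2.symm)
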